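/- Let q be odd, η ∈ 𝔽_q^*, and 3 ≤ r ≤ q/4. For any b ∈ 𝔽_q, there exist pairwise distinct x₁,…,x_r ∈ 𝔽_q^* such that c₁ − η c₂ + η c₁² + b = 0, where c₁ = −(x₁+⋯+x_r) and c₂ = Σ_{i<j} x_i x_j. -/

import Mathlib

/-- The `k`-th elementary symmetric polynomial in `x₁, …, x_r`. -/
noncomputable def esymmF {F : Type*} [CommRing F] {r : ℕ} (x : Fin r → F) (k : ℕ) : F :=
  ∑ s ∈ Finset.powersetCard k (Finset.univ : Finset (Fin r)), ∏ i ∈ s, x i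

theorem quad_card {F : Type*} [Field F] [Fintype F] [DecidableEq F] (p l s : F)
    (h : p ≠ 0 ∨ l ≠ 0) :
    (Finset.univ.filter (fun u : F => p * u ^ 2 + l * u + s = 0)).card ≤ 2 := by
  classical
  set P : Polynomial F := Polynomial.C p * Polynomial.X ^ 2 + Polynomial.C l * Polynomial.X
    + Polynomial.C s with hP
  have hP0 : P ≠ 0 := by
    intro h0
    have h1 : P.coeff 2 = 0 := by rw [h0]; simp
    have h2 : P.coeff 1 = 0 := by rw [h0]; simp
    simp [hP, Polynomial.coeff_C, Polynomial.coeff_X_pow] at h1 h2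
    rcases h with h | h
    · exact h h1
    · exact h h2
  have hdeg : P.natDegree ≤ 2 := Polynomial.natDegree_quadratic_le
  have hsub : (Finset.univ.filter (fun u : F => p * u ^ 2 + l * u + s = 0)) ⊆
      P.roots.toFinset := by
    intro u hu
    simp only [Finset.mem_filter, Finset.mem_univ, true_and] at hu
    rw [Multiset.mem_toFinset, Polynomial.mem_roots hP0]
    simp [hP, hu]
  calc _ ≤ P.roots.toFinset.card := Finset.card_le_card hsub
    _ ≤ P.roots.card := Multiset.toFinset_card_le _
    _ ≤ P.natDegree := Polynomial.card_roots' P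
    _ ≤ 2 := hdeg

theorem esymm_two {F ι : Type*} [CommRing F] [DecidableEq ι] (x : ι → F) (s : Finset ι) :
    2 * ∑ t ∈ Finset.powersetCard 2 s, ∏ i ∈ t, x i = (∑ i ∈ s, x i) ^ 2 - ∑ i ∈ s, x i ^ 2 := by
  induction s using Finset.induction_on with
  | empty =>
    have h0 : Finset.powersetCard 2 (∅ : Finset ι) = ∅ :=
      Finset.powersetCard_eq_empty.mpr (by simp)
    rw [h0]; simp
  | insert a s ha ih =>
    rw [Finset.powersetCard_succ_insert ha, Finset.sum_union, Finset.sum_image,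
      Finset.powersetCard_one, Finset.sum_map, mul_add, ih, Finset.sum_insert ha,
      Finset.sum_insert ha]
    · have : ∑ i ∈ s, ∏ j ∈ insert a {i}, x j = ∑ i ∈ s, x a * x i := by
        apply Finset.sum_congr rfl
        intro i hi
        rw [Finset.prod_pair]
        rintro rfl
        exact ha hi
      simp only [Function.Embedding.coeFn_mk]
      rw [this, ← Finset.mul_sum]
      ring
    · intro t ht t' ht' h
      rw [Finset.mem_coe, Finset.mem_powersetCard] at ht ht'
      have h1 : a ∉ t := fun h => ha (ht.1 h)
      have h2 : a ∉ t' := fun h => ha (ht'.1 h)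
      rw [← Finset.erase_insert h1, ← Finset.erase_insert h2]
      rw [h]
    · rw [Finset.disjoint_left]
      intro t ht ht'
      rw [Finset.mem_powersetCard] at ht
      rw [Finset.mem_image] at ht'
      obtain ⟨t', _, rfl⟩ := ht'
      exact ha (ht.1 (Finset.mem_insert_self _ _))

theorem conic_point {F : Type*} [Field F] [Fintype F] (hodd : Odd (Fintype.card F))
    (h2 : (2 : F) ≠ 0) (a k : F) (hnd : a ^ 2 ≠ 3 * k) :
    ∃ u v : F, u ^ 2 + u * v + v ^ 2 + a * (u + v) + k = 0 := by
  suffices h : ∃ d w : F, d ^ 2 + (3 * w ^ 2 + 4 * a * w + 4 * k) = 0 by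
    obtain ⟨d, w, h⟩ := h
    refine ⟨(w + d) / 2, (w - d) / 2, ?_⟩
    field_simp
    linear_combination h
  by_cases h3 : (3 : F) = 0
  · have ha : a ≠ 0 := by
      rintro rfl
      apply hnd
      rw [h3]; ring
    refine ⟨0, -k / a, ?_⟩
    rw [h3]
    field_simp
    ring
  · have hd1 : (Polynomial.X ^ 2 : Polynomial F).degree = 2 := by simp
    have hd2 : (Polynomial.C (3 : F) * Polynomial.X ^ 2 + Polynomial.C (4 * a) * Polynomial.X
      + Polynomial.C (4 * k)).degree = 2 := Polynomial.degree_quadratic h3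
    obtain ⟨d, w, h⟩ := FiniteField.exists_root_sum_quadratic hd1 hd2 (Nat.odd_iff.mp hodd)
    refine ⟨d, w, ?_⟩
    simpa using h

theorem conic_card {F : Type*} [Field F] [Fintype F] [DecidableEq F]
    (hodd : Odd (Fintype.card F))
    (h2 : (2 : F) ≠ 0) (a k : F) (hnd : a ^ 2 ≠ 3 * k) :
    Fintype.card F ≤ (Finset.univ.filter (fun p : F × F =>
      p.1 ^ 2 + p.1 * p.2 + p.2 ^ 2 + a * (p.1 + p.2) + k = 0)).card + 1 := by
  obtain ⟨u, v, h⟩ := conic_point hodd h2 a k hnd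
  have hgrad : ¬ (2 * u + v + a = 0 ∧ 2 * v + u + a = 0) := by
    rintro ⟨e1, e2⟩
    apply hnd
    have : 2 * (a ^ 2 - 3 * k) = 0 := by
      linear_combination (-6 : F) * h + (3 * u + a) * e1 + (3 * v + a) * e2
    have := (mul_eq_zero.mp this).resolve_left h2
    linear_combination this
  -- directions
  set D : Finset F := Finset.univ.filter (fun m : F => ¬ (1 * m ^ 2 + 1 * m + 1 = 0)) with hD
  have hDcard : Fintype.card F ≤ D.card + 2 := by
    have := Finset.card_filter_add_card_filter_not (s := (Finset.univ : Finset F))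
      (fun m : F => 1 * m ^ 2 + 1 * m + 1 = 0)
    have h' := quad_card (1 : F) 1 1 (Or.inl one_ne_zero)
    rw [Finset.card_univ] at this
    rw [hD]
    omega
  let t : F → F := fun m => -((2 * u + v + a) + (2 * v + u + a) * m) / (1 * m ^ 2 + 1 * m + 1)
  let f : F → F × F := fun m => (u + t m, v + t m * m)
  let P : F × F := (u, v - (2 * v + u + a))
  have hts : ∀ m ∈ D, t m * (1 * m ^ 2 + 1 * m + 1) = -((2 * u + v + a) + (2 * v + u + a) * m) := by
    intro m hm
    simp only [hD, Finset.mem_filter, Finset.mem_univ, true_and] at hm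
    exact div_mul_cancel₀ _ hm
  have hinj : Set.InjOn f D := by
    intro m hm m' hm' hf
    have e1 := hts m hm
    have e2 := hts m' hm'
    simp only [f, Prod.mk.injEq, add_right_inj] at hf
    obtain ⟨f1, f2⟩ := hf
    by_contra hne
    have ht : t m * (m - m') = 0 := by rw [← f1] at f2; linear_combination f2
    have ht := (mul_eq_zero.mp ht).resolve_right (sub_ne_zero.mpr hne)
    rw [← f1, ht] at e2
    rw [ht] at e1
    have : (2 * v + u + a) * (m - m') = 0 := by linear_combination e1 - e2
    have := (mul_eq_zero.mp this).resolve_right (sub_ne_zero.mpr hne)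
    apply hgrad
    refine ⟨?_, this⟩
    rw [this] at e1
    linear_combination e1
  have hP : P ∉ D.image f := by
    intro hh
    obtain ⟨m, hm, hf⟩ := Finset.mem_image.mp hh
    have e1 := hts m hm
    simp only [f, P, Prod.mk.injEq] at hf
    obtain ⟨f1, f2⟩ := hf
    have ht : t m = 0 := by linear_combination f1
    rw [ht] at e1 f2
    have : 2 * v + u + a = 0 := by linear_combination f2
    apply hgrad
    refine ⟨?_, this⟩
    rw [this] at e1
    linear_combination e1
  have hsub : insert P (D.image f) ⊆ (Finset.univ.filter (fun p : F × F =>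
      p.1 ^ 2 + p.1 * p.2 + p.2 ^ 2 + a * (p.1 + p.2) + k = 0)) := by
    intro p hp
    rw [Finset.mem_filter]
    refine ⟨Finset.mem_univ _, ?_⟩
    rcases Finset.mem_insert.mp hp with rfl | hp
    · simp only [P]
      linear_combination h
    · obtain ⟨m, hm, rfl⟩ := Finset.mem_image.mp hp
      have e1 := hts m hm
      simp only [f]
      linear_combination h + t m * e1
  have := Finset.card_le_card hsub
  rw [Finset.card_insert_of_notMem hP, Finset.card_image_of_injOn hinj] at this
  omega

theorem exists_Y {F : Type*} [Field F] [Fintype F] [DecidableEq F]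
    (h2 : (2 : F) ≠ 0) (n : ℕ) (hn : n + 3 < Fintype.card F) (e C : F) :
    ∃ Y : Finset F, Y.card = n + 1 ∧ 0 ∉ Y ∧
      (∑ y ∈ Y, y - e) ^ 2 + 3 * ∑ y ∈ Y, y ^ 2 - 3 * C ≠ 0 := by
  obtain ⟨Y, hY, hc⟩ := Finset.exists_subset_card_eq (s := (Finset.univ : Finset F).erase 0)
    (n := n) (by rw [Finset.card_erase_of_mem (Finset.mem_univ _), Finset.card_univ]; omega)
  have h0 : (0 : F) ∉ Y := fun h => by simpa using hY h
  set A := ∑ y ∈ Y, y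
  set Q := ∑ y ∈ Y, y ^ 2
  have h4 : (4 : F) ≠ 0 := by
    have : (4 : F) = 2 * 2 := by norm_num
    rw [this]; exact mul_ne_zero h2 h2
  have hq := quad_card (4 : F) (2 * (A - e)) ((A - e) ^ 2 + 3 * Q - 3 * C) (Or.inl h4)
  set R := Finset.univ.filter (fun u : F => 4 * u ^ 2 + 2 * (A - e) * u +
    ((A - e) ^ 2 + 3 * Q - 3 * C) = 0)
  obtain ⟨z, hz⟩ : ∃ z, z ∉ insert 0 Y ∪ R := by
    by_contra! hall
    have h1 : insert 0 Y ∪ R = Finset.univ := Finset.eq_univ_iff_forall.mpr hall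
    have h3 := Finset.card_union_le (insert 0 Y) R
    rw [h1, Finset.card_univ, Finset.card_insert_of_notMem h0] at h3
    omega
  simp only [Finset.mem_union, Finset.mem_insert, not_or] at hz
  obtain ⟨⟨hz0, hzY⟩, hzR⟩ := hz
  refine ⟨insert z Y, ?_, ?_, ?_⟩
  · rw [Finset.card_insert_of_notMem hzY, hc]
  · simp [h0, Ne.symm hz0]
  · rw [Finset.sum_insert hzY, Finset.sum_insert hzY]
    intro hh
    apply hzR
    simp only [R, Finset.mem_filter, Finset.mem_univ, true_and]
    linear_combination hh

theorem exists_uv {F : Type*} [Field F] [Fintype F] [DecidableEq F]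
    (hodd : Odd (Fintype.card F))
    (h2 : (2 : F) ≠ 0) (a k : F) (hnd : a ^ 2 ≠ 3 * k) (T : Finset F)
    (hT : 4 * T.card + 3 < Fintype.card F) :
    ∃ u v : F, u ∉ T ∧ v ∉ T ∧ u ≠ v ∧ u ^ 2 + u * v + v ^ 2 + a * (u + v) + k = 0 := by
  have hS := conic_card hodd h2 a k hnd
  set S := Finset.univ.filter (fun p : F × F =>
      p.1 ^ 2 + p.1 * p.2 + p.2 ^ 2 + a * (p.1 + p.2) + k = 0) with hSdef
  let L : F → Finset F := fun c =>
    Finset.univ.filter (fun y : F => 1 * y ^ 2 + (c + a) * y + (c ^ 2 + a * c + k) = 0)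
  have hL : ∀ c, (L c).card ≤ 2 := fun c => quad_card _ _ _ (Or.inl one_ne_zero)
  let M : Finset F := Finset.univ.filter (fun y : F => 3 * y ^ 2 + (2 * a) * y + k = 0)
  have hM : M.card ≤ 2 := by
    apply quad_card
    by_contra! hh
    obtain ⟨h3, ha⟩ := hh
    have ha := (mul_eq_zero.mp ha).resolve_left h2
    apply hnd
    rw [h3, ha]; ring
  let B : Finset (F × F) := (T.biUnion fun c => (L c).image fun y => (c, y)) ∪
    (T.biUnion fun c => (L c).image fun y => (y, c)) ∪ M.image fun y => (y, y)
  have hB : B.card ≤ T.card * 2 + T.card * 2 + 2 := by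
    refine (Finset.card_union_le _ _).trans (add_le_add ((Finset.card_union_le _ _).trans
      (add_le_add ?_ ?_)) (Finset.card_image_le.trans hM))
    · exact Finset.card_biUnion_le_card_mul _ _ _ fun c _ => Finset.card_image_le.trans (hL c)
    · exact Finset.card_biUnion_le_card_mul _ _ _ fun c _ => Finset.card_image_le.trans (hL c)
  obtain ⟨p, hpS, hpB⟩ := Finset.exists_mem_notMem_of_card_lt_card (s := B) (t := S) (by omega)
  obtain ⟨u, v⟩ := p
  simp only [hSdef, Finset.mem_filter, Finset.mem_univ, true_and] at hpS
  refine ⟨u, v, ?_, ?_, ?_, hpS⟩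
  · intro hu
    apply hpB
    refine Finset.mem_union_left _ (Finset.mem_union_left _ (Finset.mem_biUnion.mpr
      ⟨u, hu, Finset.mem_image.mpr ⟨v, ?_, rfl⟩⟩))
    simp only [L, Finset.mem_filter, Finset.mem_univ, true_and]
    linear_combination hpS
  · intro hv
    apply hpB
    refine Finset.mem_union_left _ (Finset.mem_union_right _ (Finset.mem_biUnion.mpr
      ⟨v, hv, Finset.mem_image.mpr ⟨u, ?_, rfl⟩⟩))
    simp only [L, Finset.mem_filter, Finset.mem_univ, true_and]
    linear_combination hpS
  · intro huv
    subst huv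
    apply hpB
    refine Finset.mem_union_right _ (Finset.mem_image.mpr ⟨u, ?_, rfl⟩)
    simp only [M, Finset.mem_filter, Finset.mem_univ, true_and]
    linear_combination hpS

/-- For odd `q`, `η ∈ 𝔽_q^*`, `3 ≤ r ≤ q/4`, and any `b ∈ 𝔽_q`, there exist pairwise
distinct `x₁, …, x_r ∈ 𝔽_q^*` with `c₁ - η c₂ + η c₁² + b = 0`, where
`c₁ = -(x₁ + ⋯ + x_r)` and `c₂ = ∑_{i<j} x_i x_j`. -/
theorem stmt_7 {F : Type*} [Field F] [Fintype F]
    (hodd : Odd (Fintype.card F)) (η : F) (hη : η ≠ 0)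
    (r : ℕ) (hr3 : 3 ≤ r) (hr : r ≤ Fintype.card F / 4) (b : F) :
    ∃ x : Fin r → F, Function.Injective x ∧ (∀ i, x i ≠ 0) ∧
      (-(∑ i : Fin r, x i)) - η * esymmF x 2 + η * (-(∑ i : Fin r, x i)) ^ 2 + b = 0 := by
  classical
  have h2 : (2 : F) ≠ 0 := by
    apply Ring.two_ne_zero
    intro h
    have := FiniteField.even_card_of_char_two h
    have := Nat.odd_iff.mp hodd
    omega
  have hq := Nat.odd_iff.mp hodd
  obtain ⟨n, rfl⟩ : ∃ n, r = n + 3 := ⟨r - 3, by omega⟩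
  obtain ⟨e, he⟩ : ∃ e : F, η * e = 1 := ⟨η⁻¹, mul_inv_cancel₀ hη⟩
  obtain ⟨Y, hYc, hY0, hY⟩ := exists_Y h2 n (by omega) e (e ^ 2 - 2 * e * b)
  set A := ∑ y ∈ Y, y with hA
  set Q := ∑ y ∈ Y, y ^ 2 with hQ
  obtain ⟨k, hk⟩ : ∃ k : F, 2 * k = (A - e) ^ 2 + Q - (e ^ 2 - 2 * e * b) :=
    ⟨((A - e) ^ 2 + Q - (e ^ 2 - 2 * e * b)) / 2, mul_div_cancel₀ _ h2⟩
  have hnd : (A - e) ^ 2 ≠ 3 * k := by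
    intro hh
    apply hY
    linear_combination (-2 : F) * hh - 3 * hk
  obtain ⟨u, v, hu, hv, huv, huveq⟩ := exists_uv hodd h2 (A - e) k hnd (insert 0 Y)
    (by rw [Finset.card_insert_of_notMem hY0]; omega)
  simp only [Finset.mem_insert, not_or] at hu hv
  have hvY : u ∉ insert v Y := by simp [huv, hu.2]
  set Z := insert u (insert v Y) with hZ
  have hZc : Z.card = n + 3 := by
    rw [hZ, Finset.card_insert_of_notMem hvY, Finset.card_insert_of_notMem hv.2, hYc]
  let φ := Z.equivFinOfCardEq hZc
  have hsum : ∀ g : F → F, ∑ i : Fin (n + 3), g (φ.symm i : F) = ∑ z ∈ Z, g z := by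
    intro g
    rw [Equiv.sum_comp φ.symm (fun z : Z => g z)]
    exact Finset.sum_coe_sort Z g
  refine ⟨fun i => (φ.symm i : F), ?_, ?_, ?_⟩
  · exact Subtype.val_injective.comp φ.symm.injective
  · intro i h0
    have := (φ.symm i).2
    simp only at h0
    rw [h0, hZ, Finset.mem_insert, Finset.mem_insert] at this
    rcases this with h | h | h
    · exact hu.1 h.symm
    · exact hv.1 h.symm
    · exact hY0 h
  · have hE := esymm_two (fun i : Fin (n + 3) => (φ.symm i : F)) Finset.univ
    have s1 := hsum (fun z => z)
    have s2 := hsum (fun z => z ^ 2)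
    have z1 : ∑ z ∈ Z, z = u + (v + A) := by
      rw [hZ, Finset.sum_insert hvY, Finset.sum_insert hv.2]
    have z2 : ∑ z ∈ Z, z ^ 2 = u ^ 2 + (v ^ 2 + Q) := by
      rw [hZ, Finset.sum_insert hvY, Finset.sum_insert hv.2]
    rw [z1] at s1
    rw [z2] at s2
    unfold esymmF
    rw [s1, s2] at hE
    rw [s1]
    apply (mul_eq_zero.mp (?_ : (2 : F) * _ = 0)).resolve_left h2
    linear_combination (-η) * hE + 2 * η * huveq - η * hk + (2 * (u + v + A) - 2 * b) * he
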